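/- Let S be an inductively generated basic cover. For every preframe X and every dcpo homomorphism f : Sat(S) → X, there exists a unique preframe homomorphism F : Sat(Lower(S)) → X such that F ∘ σ_L* = f, where σ_L* : Sat(S) → Sat(Lower(S)) is the suplattice homomorphism induced by the basic cover map σ_L : Lower(S) → S. -/

import Mathlib

noncomputable section
open Classical

universe u v

namespace FTP

/-! ### Basic covers -/

/-- `U ◁ V` : every element of `U` is covered by `V`. -/
def covS {S : Type*} (cov : S → Set S → Prop) (U V : Set S) : Prop :=
  ∀ a ∈ U, cov a V

/-- A basic cover: reflexivity and transitivity. -/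
def IsBasicCover {S : Type*} (cov : S → Set S → Prop) : Prop :=
  (∀ (a : S) (U : Set S), a ∈ U → cov a U) ∧
  (∀ (a : S) (U V : Set S), cov a U → covS cov U V → cov a V)

/-- the way-below relation `a ≪ b`. -/
def wb {S : Type*} (cov : S → Set S → Prop) (a b : S) : Prop :=
  ∀ U : Set S, cov b U → ∃ U₀ : Finset S, ↑U₀ ⊆ U ∧ cov a ↑U₀

/-- the way-below relation between subsets `U ≪ V`. -/
def wbS {S : Type*} (cov : S → Set S → Prop) (U V : Set S) : Prop :=
  ∀ W : Set S, covS cov V W → ∃ W₀ : Finset S, ↑W₀ ⊆ W ∧ covS cov U ↑W₀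

/-- A continuous basic cover, with the witnessing function `w`. -/
def IsContinuous {S : Type*} (cov : S → Set S → Prop) (w : S → Set S) : Prop :=
  (∀ a : S, ∀ b ∈ w a, wb cov b a) ∧ (∀ a : S, cov a (w a))

/-- splitting subsets. -/
def Splitting {S : Type*} (cov : S → Set S → Prop) (V : Set S) : Prop :=
  ∀ (a : S) (U : Set S), a ∈ V → cov a U → (V ∩ U).Nonempty

/-- located subsets. -/
def Located {S : Type*} (cov : S → Set S → Prop) (V : Set S) : Prop :=
  Splitting cov V ∧ ∀ a b : S, wb cov a b → a ∉ V ∨ b ∈ V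

/-- inverse image of a relation. -/
def rinv {α β : Type*} (r : α → β → Prop) (U : Set β) : Set α :=
  {x | ∃ a ∈ U, r x a}

/-- basic cover maps. -/
def IsBCM {α β : Type*} (cov : α → Set α → Prop) (cov' : β → Set β → Prop)
    (r : α → β → Prop) : Prop :=
  ∀ (a : β) (U : Set β), cov' a U → covS cov (rinv r {a}) (rinv r U)

/-- perfect maps. -/
def IsPerfect {α β : Type*} (cov : α → Set α → Prop) (cov' : β → Set β → Prop)
    (r : α → β → Prop) : Prop :=
  ∀ a b : β, wb cov' a b → wbS cov (rinv r {a}) (rinv r {b})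

/-- the terminal basic cover `1 = ({∗}, ∈)`. -/
def unitCov : Unit → Set Unit → Prop := fun x U => x ∈ U

/-! ### Formal topologies -/

/-- `U ↓ V` with respect to a preorder `le`. -/
def down {S : Type*} (le : S → S → Prop) (U V : Set S) : Set S :=
  {c | ∃ a ∈ U, ∃ b ∈ V, le c a ∧ le c b}

/-- A formal topology: a basic cover together with a compatible preorder. -/
def IsFormalTopology {S : Type*} (cov : S → Set S → Prop) (le : S → S → Prop) : Prop :=
  IsBasicCover cov ∧ Reflexive le ∧ Transitive le ∧
  (∀ a b : S, le a b → cov a {b}) ∧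
  (∀ (a : S) (U V : Set S), cov a U → cov a V → cov a (down le U V))

/-- formal topology maps. -/
def IsFTM {α β : Type*} (cov : α → Set α → Prop) (le : α → α → Prop)
    (cov' : β → Set β → Prop) (le' : β → β → Prop) (r : α → β → Prop) : Prop :=
  IsBCM cov cov' r ∧
  covS cov Set.univ (rinv r Set.univ) ∧
  ∀ a b : β, covS cov (down le (rinv r {a}) (rinv r {b})) (rinv r (down le' {a} {b}))

/-- the order on maps. -/
def MapLE {α β : Type*} (cov : α → Set α → Prop) (r s : α → β → Prop) : Prop :=
  ∀ a : β, covS cov (rinv r {a}) (rinv s {a})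

/-- equality of maps. -/
def MapEq {α β : Type*} (cov : α → Set α → Prop) (r s : α → β → Prop) : Prop :=
  MapLE cov r s ∧ MapLE cov s r

/-- composition of relational maps (`comp s r = s ∘ r`). -/
def comp {α β γ : Type*} (s : β → γ → Prop) (r : α → β → Prop) : α → γ → Prop :=
  fun x c => ∃ b, r x b ∧ s b c

/-- `b* = {c | c ↓ b ◁ ∅}`. -/
def star {S : Type*} (cov : S → Set S → Prop) (le : S → S → Prop) (b : S) : Set S :=
  {c | covS cov (down le {c} {b}) ∅}

/-- `b ⋘ a` iff `S ◁ b* ∪ {a}`. -/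
def wc {S : Type*} (cov : S → Set S → Prop) (le : S → S → Prop) (b a : S) : Prop :=
  covS cov Set.univ (star cov le b ∪ {a})

/-- regular formal topologies. -/
def Regular {S : Type*} (cov : S → Set S → Prop) (le : S → S → Prop) : Prop :=
  ∀ a : S, cov a {b | wc cov le b a}

/-- compactness: `S ≪ S`. -/
def Compact {S : Type*} (cov : S → Set S → Prop) : Prop :=
  wbS cov Set.univ Set.univ

/-- stability: `a ≪ a'` and `b ≪ b'` imply `a↓b ≪ a'↓b'`. -/
def Stable {S : Type*} (cov : S → Set S → Prop) (le : S → S → Prop) : Prop :=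
  ∀ a a' b b' : S, wb cov a a' → wb cov b b' →
    wbS cov (down le {a} {b}) (down le {a'} {b'})

/-- isomorphism of formal topologies. -/
def IsIso {α β : Type*} (cov : α → Set α → Prop) (le : α → α → Prop)
    (cov' : β → Set β → Prop) (le' : β → β → Prop) : Prop :=
  ∃ (r : α → β → Prop) (s : β → α → Prop),
    IsFTM cov le cov' le' r ∧ IsFTM cov' le' cov le s ∧
    MapEq cov (comp s r) (fun a b => a = b) ∧
    MapEq cov' (comp r s) (fun a b => a = b)

/-! ### Geometric theories and the covers they present -/

/-- the preorder `A ≤ B ↔ B ⊆ A` on finite sets of generators. -/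
def supord {P : Type*} : Finset P → Finset P → Prop := fun A B => B ⊆ A

/-- The cover on `Finset P` inductively generated by a geometric theory `T`
(an axiom `T A 𝒞` means `⋀A ⊢ ⋁_{B ∈ 𝒞} ⋀B`). -/
inductive GCov {P : Type*} (T : Finset P → Set (Finset P) → Prop) :
    Finset P → Set (Finset P) → Prop where
  | refl {A : Finset P} {𝒰 : Set (Finset P)} : A ∈ 𝒰 → GCov T A 𝒰
  | le {A B : Finset P} {𝒰 : Set (Finset P)} : B ⊆ A → GCov T B 𝒰 → GCov T A 𝒰
  | ax {A : Finset P} {𝒞 𝒰 : Set (Finset P)} (C : Finset P) :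
      T A 𝒞 → (∀ B ∈ 𝒞, GCov T (C ∪ B) 𝒰) → GCov T (C ∪ A) 𝒰

theorem GCov_trans {P : Type*} {T : Finset P → Set (Finset P) → Prop}
    {A : Finset P} {𝒰 𝒱 : Set (Finset P)}
    (h : GCov T A 𝒰) (h' : ∀ B ∈ 𝒰, GCov T B 𝒱) : GCov T A 𝒱 := by
  induction h with
  | refl hA => exact h' _ hA
  | le hBA _ ih => exact GCov.le hBA (ih h')
  | ax C hT _ ih => exact GCov.ax C hT (fun B hB => ih B hB h')

theorem GCov_isBasicCover {P : Type*} (T : Finset P → Set (Finset P) → Prop) :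
    IsBasicCover (GCov T) :=
  ⟨fun _ _ h => GCov.refl h, fun _ _ _ h h' => GCov_trans h h'⟩

/-! ### The patch, Lawson and lower powerlocale theories -/

/-- generators of the patch/Lawson theories : `r a` and `l A`. -/
inductive PatchGen (S : Type u) : Type u where
  | r : S → PatchGen S
  | l : Finset S → PatchGen S

/-- The geometric theory `T_P` presenting the patch of a stably locally compact
formal topology. -/
inductive PatchThy {S : Type*} (cov : S → Set S → Prop) (le : S → S → Prop) :
    Finset (PatchGen S) → Set (Finset (PatchGen S)) → Prop where
  | R1 : PatchThy cov le ∅ {B | ∃ a : S, B = {PatchGen.r a}}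
  | R2 (a b : S) :
      PatchThy cov le {PatchGen.r a, PatchGen.r b}
        {B | ∃ c ∈ down le {a} {b}, B = {PatchGen.r c}}
  | R3 (a : S) (A : Finset S) :
      cov a ↑A → PatchThy cov le {PatchGen.r a} {B | ∃ b ∈ A, B = {PatchGen.r b}}
  | R4 (a : S) :
      PatchThy cov le {PatchGen.r a} {B | ∃ b : S, wb cov b a ∧ B = {PatchGen.r b}}
  | L1 : PatchThy cov le ∅ {({PatchGen.l ∅} : Finset (PatchGen S))}
  | L2 (A B : Finset S) :
      covS cov ↑A ↑B →
      PatchThy cov le {PatchGen.l B} {({PatchGen.l A} : Finset (PatchGen S))}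
  | L3 (A B : Finset S) :
      PatchThy cov le {PatchGen.l A, PatchGen.l B}
        {D | ∃ C : Finset S, wbS cov ↑A ↑C ∧ wbS cov ↑B ↑C ∧ D = {PatchGen.l C}}
  | Loc (a b : S) :
      wb cov a b →
      PatchThy cov le ∅
        {({PatchGen.l {a}} : Finset (PatchGen S)), ({PatchGen.r b} : Finset (PatchGen S))}
  | D (a : S) :
      PatchThy cov le {PatchGen.l {a}, PatchGen.r a} (∅ : Set (Finset (PatchGen S)))

/-- the cover of `Patch(S)`. -/
def patchCov {S : Type*} (cov : S → Set S → Prop) (le : S → S → Prop) :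
    Finset (PatchGen S) → Set (Finset (PatchGen S)) → Prop :=
  GCov (PatchThy cov le)

/-- the counit `ε_P : Patch(S) → S`. -/
def epsP {S : Type*} (cov : S → Set S → Prop) (le : S → S → Prop) :
    Finset (PatchGen S) → S → Prop :=
  fun 𝔄 a => patchCov cov le 𝔄 {({PatchGen.r a} : Finset (PatchGen S))}

/-- The geometric theory `T_L` presenting the Lawson topology of a continuous
basic cover (the axioms of `T_P` without (R1), (R2)). -/
inductive LawsonThy {S : Type*} (cov : S → Set S → Prop) :
    Finset (PatchGen S) → Set (Finset (PatchGen S)) → Prop where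
  | R3 (a : S) (A : Finset S) :
      cov a ↑A → LawsonThy cov {PatchGen.r a} {B | ∃ b ∈ A, B = {PatchGen.r b}}
  | R4 (a : S) :
      LawsonThy cov {PatchGen.r a} {B | ∃ b : S, wb cov b a ∧ B = {PatchGen.r b}}
  | L1 : LawsonThy cov ∅ {({PatchGen.l ∅} : Finset (PatchGen S))}
  | L2 (A B : Finset S) :
      covS cov ↑A ↑B →
      LawsonThy cov {PatchGen.l B} {({PatchGen.l A} : Finset (PatchGen S))}
  | L3 (A B : Finset S) :
      LawsonThy cov {PatchGen.l A, PatchGen.l B}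
        {D | ∃ C : Finset S, wbS cov ↑A ↑C ∧ wbS cov ↑B ↑C ∧ D = {PatchGen.l C}}
  | Loc (a b : S) :
      wb cov a b →
      LawsonThy cov ∅
        {({PatchGen.l {a}} : Finset (PatchGen S)), ({PatchGen.r b} : Finset (PatchGen S))}
  | D (a : S) :
      LawsonThy cov {PatchGen.l {a}, PatchGen.r a} (∅ : Set (Finset (PatchGen S)))

/-- the cover of the Lawson topology `L(S)`. -/
def lawsonCov {S : Type*} (cov : S → Set S → Prop) :
    Finset (PatchGen S) → Set (Finset (PatchGen S)) → Prop :=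
  GCov (LawsonThy cov)

/-- the counit `ε_L : L(S) → S`. -/
def epsL {S : Type*} (cov : S → Set S → Prop) : Finset (PatchGen S) → S → Prop :=
  fun 𝔄 a => lawsonCov cov 𝔄 {({PatchGen.r a} : Finset (PatchGen S))}

/-- The theory presenting the lower powerlocale of a continuous basic cover:
generators `a ∈ S`, axioms (R3) and (R4). -/
inductive LowerThy {S : Type*} (cov : S → Set S → Prop) :
    Finset S → Set (Finset S) → Prop where
  | R3 (a : S) (A : Finset S) :
      cov a ↑A → LowerThy cov {a} {B | ∃ b ∈ A, B = ({b} : Finset S)}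
  | R4 (a : S) :
      LowerThy cov {a} {B | ∃ b : S, wb cov b a ∧ B = ({b} : Finset S)}

/-- the cover of the lower powerlocale `Lower(S)`. -/
def lowerCov {S : Type*} (cov : S → Set S → Prop) :
    Finset S → Set (Finset S) → Prop :=
  GCov (LowerThy cov)

/-- the counit `σ_L : Lower(S) → S`. -/
def sigmaL {S : Type*} (cov : S → Set S → Prop) : Finset S → S → Prop :=
  fun A a => lowerCov cov A ({({a} : Finset S)} : Set (Finset S))

/-! ### de Groot duals -/

/-- `↟A = {B ∈ Fin S | A ≪ B}`. -/
def upF {S : Type*} (cov : S → Set S → Prop) (A : Finset S) : Set (Finset S) :=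
  {B | wbS cov ↑A ↑B}

/-- the finite join `⋁^F {↟A | A ∈ 𝒜}` of Scott open filters. -/
def finJoin {S : Type*} (cov : S → Set S → Prop) (le : S → S → Prop)
    (𝒜 : Finset (Finset S)) : Set (Finset S) :=
  if 𝒜 = ∅ then {B | covS cov Set.univ ↑B}
  else {B | ∃ g : Finset S → Finset S,
    (∀ A ∈ 𝒜, wbS cov ↑A ↑(g A)) ∧
    wbS cov {c | ∀ A ∈ 𝒜, ∃ b ∈ g A, le c b} ↑B}

/-- The cover `◁^D` of the de Groot dual `S^D`, inductively generated on
`(Fin S, ⊇)` by the axioms (D3) `A ◁ ↟A` and (D4). -/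
inductive DCov {S : Type*} (cov : S → Set S → Prop) (le : S → S → Prop) :
    Finset S → Set (Finset S) → Prop where
  | refl {A : Finset S} {𝒰 : Set (Finset S)} : A ∈ 𝒰 → DCov cov le A 𝒰
  | le {A B : Finset S} {𝒰 : Set (Finset S)} :
      B ⊆ A → DCov cov le B 𝒰 → DCov cov le A 𝒰
  | d3 {A A' : Finset S} {𝒰 : Set (Finset S)} :
      A ⊆ A' →
      (∀ C : Finset S, A' ⊆ C → (∃ B : Finset S, wbS cov ↑A ↑B ∧ B ⊆ C) →
        DCov cov le C 𝒰) →
      DCov cov le A' 𝒰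
  | d4 {A A' : Finset S} {𝒜 : Finset (Finset S)} {𝒰 : Set (Finset S)} :
      A ⊆ A' → upF cov A ⊆ finJoin cov le 𝒜 →
      (∀ C : Finset S, A' ⊆ C → (∃ B ∈ 𝒜, B ⊆ C) → DCov cov le C 𝒰) →
      DCov cov le A' 𝒰

/-- the cover of the Scott topology `Σ(S)` on `(Fin S, ⊇)`. -/
def scottCov {S : Type*} (cov : S → Set S → Prop) :
    Finset S → Set (Finset S) → Prop :=
  fun A 𝒰 => upF cov A ⊆ ⋃ B ∈ 𝒰, upF cov B

/-- a filter (with respect to `◁`) of basic opens, given by a set of finite subsets. -/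
def IsCovFilter {S : Type*} (cov : S → Set S → Prop) (le : S → S → Prop)
    (𝒱 : Set (Finset S)) : Prop :=
  𝒱.Nonempty ∧
  (∀ A ∈ 𝒱, ∀ B : Finset S, covS cov ↑A ↑B → B ∈ 𝒱) ∧
  (∀ A ∈ 𝒱, ∀ B ∈ 𝒱, ∃ C ∈ 𝒱, covS cov ↑C (down le ↑A ↑B))

/-- The geometric theory `T^d` presenting the de Groot dual `S^d`:
generators `l A` (identified with `A : Finset S`), axioms (L1)–(L3) and (D4). -/
inductive DGThy {S : Type*} (cov : S → Set S → Prop) (le : S → S → Prop) :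
    Finset (Finset S) → Set (Finset (Finset S)) → Prop where
  | L1 : DGThy cov le ∅ {({(∅ : Finset S)} : Finset (Finset S))}
  | L2 (A B : Finset S) :
      covS cov ↑A ↑B → DGThy cov le {B} {({A} : Finset (Finset S))}
  | L3 (A B : Finset S) :
      DGThy cov le {A, B}
        {D | ∃ C : Finset S, wbS cov ↑A ↑C ∧ wbS cov ↑B ↑C ∧ D = ({C} : Finset (Finset S))}
  | D4 (A : Finset S) (𝒜 : Finset (Finset S)) :
      upF cov A ⊆ finJoin cov le 𝒜 →
      DGThy cov le {A} {D | ∃ B ∈ 𝒜, D = ({B} : Finset (Finset S))}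

/-! ### Spectral formal topologies -/

/-- spectral formal topologies: a compatible meet-semilattice structure on the
base, with every basic element way-below itself. -/
def IsSpectral {S : Type*} (cov : S → Set S → Prop) (le : S → S → Prop)
    (one : S) (meet : S → S → S) : Prop :=
  (∀ a : S, cov a {one}) ∧
  (∀ a b : S, cov (meet a b) (down le {a} {b})) ∧
  (∀ a b : S, ∀ c ∈ down le {a} {b}, cov c {meet a b}) ∧
  (∀ a : S, wb cov a a)

/-! ### Subtopologies -/

/-- the property of being a formal-topology cover compatible with `le`. -/
def IsFTCover {S : Type*} (cov : S → Set S → Prop) (le : S → S → Prop) : Prop :=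
  IsBasicCover cov ∧ (∀ a b : S, le a b → cov a {b}) ∧
  (∀ (a : S) (U V : Set S), cov a U → cov a V → cov a (down le U V))

/-- The meet (in `SubTop(S)`) of a family of subtopology covers: the least
formal-topology cover containing all of them. -/
def covMeet {S : Type*} {ι : Sort*} (le : S → S → Prop)
    (F : ι → (S → Set S → Prop)) : S → Set S → Prop :=
  fun a U => ∀ c : S → Set S → Prop,
    IsFTCover c le → (∀ i : ι, ∀ (a' : S) (U' : Set S), F i a' U' → c a' U') → c a U

/-- the closed subtopology `C_a` determined by `{a}`. -/
def closedCov {S : Type*} (cov : S → Set S → Prop) (a : S) : S → Set S → Prop :=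
  fun c V => cov c ({a} ∪ V)

/-- the open subtopology `S_B` determined by a finite `B`. -/
def openCov {S : Type*} (cov : S → Set S → Prop) (le : S → S → Prop)
    (B : Finset S) : S → Set S → Prop :=
  fun c V => covS cov (down le {c} ↑B) V

/-- `K_A = ⋀_{A ≪ B} S_B`. -/
def KCov {S : Type*} (cov : S → Set S → Prop) (le : S → S → Prop) (A : Finset S) :
    S → Set S → Prop :=
  covMeet le (fun B : {B : Finset S // wbS cov ↑A ↑B} => openCov cov le B.1)

/-- `C_a ∨ K_A` (the join of subtopologies is the intersection of covers). -/
def CKCov {S : Type*} (cov : S → Set S → Prop) (le : S → S → Prop)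
    (a : S) (A : Finset S) : S → Set S → Prop :=
  fun c V => closedCov cov a c V ∧ KCov cov le A c V

/-- perfect subtopologies. -/
def IsPerfectSub {S : Type*} (cov : S → Set S → Prop) (le : S → S → Prop)
    (cov' : S → Set S → Prop) : Prop :=
  IsFTCover cov' le ∧ (∀ (a : S) (U : Set S), cov a U → cov' a U) ∧
  (∀ a b : S, wb cov a b → wb cov' a b)

/-- the order of `PSub(S)`: `(a,A) ≤ (b,B)` iff `C_b ∨ K_B ⊑ C_a ∨ K_A`. -/
def PSubLe {S : Type*} (cov : S → Set S → Prop) (le : S → S → Prop) :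
    S × Finset S → S × Finset S → Prop :=
  fun p q => ∀ (c : S) (V : Set S), CKCov cov le p.1 p.2 c V → CKCov cov le q.1 q.2 c V

/-- the cover of `PSub(S)`: `(a,A) ◁ U` iff `⋀{C_b ∨ K_B | (b,B) ∈ U} ⊑ C_a ∨ K_A`. -/
def covPSub {S : Type*} (cov : S → Set S → Prop) (le : S → S → Prop) :
    S × Finset S → Set (S × Finset S) → Prop :=
  fun p U => ∀ (c : S) (V : Set S), CKCov cov le p.1 p.2 c V →
    covMeet le (fun q : U => CKCov cov le q.1.1 q.1.2) c V

/-- the map `r : PSub(S) → Patch(S)` on generators. -/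
def rGenPS {S : Type*} (cov : S → Set S → Prop) (le : S → S → Prop)
    (p : S × Finset S) : PatchGen S → Prop
  | PatchGen.r b => covPSub cov le p {((b, (∅ : Finset S)) : S × Finset S)}
  | PatchGen.l B => covPSub cov le p {q : S × Finset S | q.2 = B}

/-- the map `r : PSub(S) → Patch(S)`, extended along the presentation. -/
def rPS {S : Type*} (cov : S → Set S → Prop) (le : S → S → Prop) :
    S × Finset S → Finset (PatchGen S) → Prop :=
  fun p 𝔅 => ∀ g ∈ 𝔅, covPSub cov le p (rinv (fun q g' => rGenPS cov le q g') {g})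

/-- the map `s : Patch(S) → PSub(S)`. -/
def sPS {S : Type*} (cov : S → Set S → Prop) (le : S → S → Prop) :
    Finset (PatchGen S) → (S × Finset S) → Prop :=
  fun 𝔄 p => patchCov cov le 𝔄
    ({({PatchGen.r p.1, PatchGen.l p.2} : Finset (PatchGen S))} : Set (Finset (PatchGen S)))

/-! ### Saturated subsets, dcpos and preframes -/

/-- the saturated subsets of a basic cover. -/
abbrev SatSet {α : Type*} (cov : α → Set α → Prop) : Type _ :=
  {U : Set α // ∀ a, cov a U → a ∈ U}

/-- the join of a family of saturated subsets. -/
def satSup {α : Type*} {cov : α → Set α → Prop} (hbc : IsBasicCover cov)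
    (D : Set (SatSet cov)) : SatSet cov :=
  ⟨{a | cov a (⋃ U ∈ D, (U : Set α))}, fun a h => hbc.2 a _ _ h (fun _ hb => hb)⟩

/-- inductively generated basic covers: `BGen Ax` is the cover generated by the
axiom-set with axioms `a ◁ C` for `C ∈ Ax a`. -/
inductive BGen {S : Type*} (Ax : S → Set (Set S)) : S → Set S → Prop where
  | refl {a : S} {U : Set S} : a ∈ U → BGen Ax a U
  | infty {a : S} {U : Set S} (C : Set S) :
      C ∈ Ax a → (∀ b ∈ C, BGen Ax b U) → BGen Ax a U

theorem BGen_trans {S : Type*} {Ax : S → Set (Set S)} {a : S} {U V : Set S}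
    (h : BGen Ax a U) (h' : ∀ b ∈ U, BGen Ax b V) : BGen Ax a V := by
  induction h with
  | refl ha => exact h' _ ha
  | infty C hC _ ih => exact BGen.infty C hC (fun b hb => ih b hb h')

theorem BGen_isBasicCover {S : Type*} (Ax : S → Set (Set S)) :
    IsBasicCover (BGen Ax) :=
  ⟨fun _ _ h => BGen.refl h, fun _ _ _ h h' => BGen_trans h h'⟩

/-- the lower powerlocale theory of an inductively generated basic cover. -/
inductive LowerThyAx {S : Type*} (Ax : S → Set (Set S)) :
    Finset S → Set (Finset S) → Prop where
  | mk (a : S) (C : Set S) :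
      C ∈ Ax a → LowerThyAx Ax {a} {B | ∃ b ∈ C, B = ({b} : Finset S)}

/-- the counit `σ_L : Lower(S) → S` for an inductively generated basic cover. -/
def sigmaLAx {S : Type*} (Ax : S → Set (Set S)) : Finset S → S → Prop :=
  fun A a => GCov (LowerThyAx Ax) A ({({a} : Finset S)} : Set (Finset S))

/-- the top saturated subset of a presented topology. -/
def satTop {P : Type*} (T : Finset P → Set (Finset P) → Prop) : SatSet (GCov T) :=
  ⟨Set.univ, fun _ _ => Set.mem_univ _⟩

/-- binary meets of saturated subsets of a presented topology. -/
def satInfL {P : Type*} (T : Finset P → Set (Finset P) → Prop)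
    (U V : SatSet (GCov T)) : SatSet (GCov T) :=
  ⟨{A | GCov T A (down supord (U : Set (Finset P)) (V : Set (Finset P)))},
   fun _ h => GCov_trans h (fun _ hB => hB)⟩

/-- the suplattice homomorphism `σ_L* : Sat(S) → Sat(Lower(S))`. -/
def sigmaStar {S : Type*} (Ax : S → Set (Set S)) (U : SatSet (BGen Ax)) :
    SatSet (GCov (LowerThyAx Ax)) :=
  ⟨{A : Finset S | GCov (LowerThyAx Ax) A (rinv (sigmaLAx Ax) (U : Set S))},
   fun _ h => GCov_trans h (fun _ hB => hB)⟩

/-- a preframe structure on a partial order: finite meets and directed joins,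
with finite meets distributing over directed joins. -/
structure PreframeStr (X : Type*) [PartialOrder X] where
  top : X
  inf : X → X → X
  dSup : Set X → X
  le_top : ∀ x, x ≤ top
  inf_le_left : ∀ x y, inf x y ≤ x
  inf_le_right : ∀ x y, inf x y ≤ y
  le_inf : ∀ x y z, x ≤ y → x ≤ z → x ≤ inf y z
  le_dSup : ∀ d : Set X, d.Nonempty → DirectedOn (· ≤ ·) d → ∀ x ∈ d, x ≤ dSup d
  dSup_le : ∀ d : Set X, d.Nonempty → DirectedOn (· ≤ ·) d →
    ∀ z, (∀ x ∈ d, x ≤ z) → dSup d ≤ z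
  distrib : ∀ (x : X) (d : Set X), d.Nonempty → DirectedOn (· ≤ ·) d →
    inf x (dSup d) = dSup ((fun y => inf x y) '' d)

/-- dcpo homomorphisms out of `Sat(S)`. -/
def IsDcpoHom {α : Type*} {cov : α → Set α → Prop} (hbc : IsBasicCover cov)
    {X : Type*} [PartialOrder X] (PF : PreframeStr X) (f : SatSet cov → X) : Prop :=
  Monotone f ∧
  ∀ D : Set (SatSet cov), D.Nonempty → DirectedOn (· ≤ ·) D →
    f (satSup hbc D) = PF.dSup (f '' D)

/-- preframe homomorphisms out of the frame of a presented topology. -/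
def IsPreframeHomL {P : Type*} (T : Finset P → Set (Finset P) → Prop)
    {X : Type*} [PartialOrder X] (PF : PreframeStr X)
    (F : SatSet (GCov T) → X) : Prop :=
  Monotone F ∧ F (satTop T) = PF.top ∧
  (∀ U V, F (satInfL T U V) = PF.inf (F U) (F V)) ∧
  ∀ D : Set (SatSet (GCov T)), D.Nonempty → DirectedOn (· ≤ ·) D →
    F (satSup (GCov_isBasicCover T) D) = PF.dSup (F '' D)

/-! ### Located subsets: auxiliary notions -/

/-- the lower part `L_V` associated to a located subset `V`. -/
def LV {S : Type*} (cov : S → Set S → Prop) (V : Set S) : Set S :=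
  {a | ∃ A : Finset S, wbS cov {a} ↑A ∧ (↑A ∩ V : Set S) = ∅}

/-- cuts of a continuous basic cover. -/
def IsCut {S : Type*} (cov : S → Set S → Prop) (L U : Set S) : Prop :=
  (∀ (a : S) (A : Finset S), cov a ↑A → a ∈ U → ((↑A : Set S) ∩ U).Nonempty) ∧
  (∀ a ∈ U, ∃ b : S, wb cov b a ∧ b ∈ U) ∧
  (∀ (a : S) (A : Finset S), cov a ↑A → (↑A : Set S) ⊆ L → a ∈ L) ∧
  (∀ a ∈ L, ∃ A : Finset S, wbS cov {a} ↑A ∧ (↑A : Set S) ⊆ L) ∧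
  (∀ a b : S, wb cov a b → a ∈ L ∨ b ∈ U) ∧
  L ∩ U = ∅

end FTP

namespace FTP

/-! ### Finite meets and directed joins in preframes -/

namespace PreframeStr

variable {X : Type*} [PartialOrder X]

theorem isLUB_dSup (PF : PreframeStr X) {d : Set X} (hne : d.Nonempty) (hd : DirectedOn (· ≤ ·) d) :
    IsLUB d (PF.dSup d) :=
  ⟨PF.le_dSup d hne hd, fun z hz => PF.dSup_le d hne hd z hz⟩

theorem isGLB_insert (PF : PreframeStr X) {x m : X} {t : Set X} (hm : IsGLB t m) :
    IsGLB (insert x t) (PF.inf x m) := by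
  refine ⟨?_, fun z hz => PF.le_inf _ _ _ (hz (Set.mem_insert _ _))
    (hm.2 fun y hy => hz (Set.mem_insert_of_mem _ hy))⟩
  rintro y (rfl | hy)
  · exact PF.inf_le_left _ _
  · exact (PF.inf_le_right _ _).trans (hm.1 hy)

theorem exists_isGLB_of_finite (PF : PreframeStr X) {t : Set X} (ht : t.Finite) : ∃ m, IsGLB t m := by
  induction t, ht using Set.Finite.induction_on with
  | empty => exact ⟨PF.top, by simp, fun z _ => PF.le_top z⟩
  | insert _ _ ih =>
    obtain ⟨m, hm⟩ := ih
    exact ⟨_, PF.isGLB_insert hm⟩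

/-- Distributivity of binary meets over directed joins, as an elimination rule. -/
theorem le_of_le_isLUB (PF : PreframeStr X) {d : Set X} (hne : d.Nonempty) (hd : DirectedOn (· ≤ ·) d)
    {m x z : X} (hm : IsLUB d m) (hx : x ≤ m) (h : ∀ y ∈ d, PF.inf x y ≤ z) : x ≤ z := by
  obtain rfl : m = PF.dSup d := hm.unique (PF.isLUB_dSup hne hd)
  have hd' : DirectedOn (· ≤ ·) ((fun y => PF.inf x y) '' d) := by
    rintro _ ⟨y, hy, rfl⟩ _ ⟨y', hy', rfl⟩
    obtain ⟨w, hw, h1, h2⟩ := hd y hy y' hy'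
    exact ⟨_, ⟨w, hw, rfl⟩,
      PF.le_inf _ _ _ (PF.inf_le_left _ _) ((PF.inf_le_right _ _).trans h1),
      PF.le_inf _ _ _ (PF.inf_le_left _ _) ((PF.inf_le_right _ _).trans h2)⟩
  calc x ≤ PF.inf x (PF.dSup d) := PF.le_inf _ _ _ le_rfl hx
    _ = _ := PF.distrib x d hne hd
    _ ≤ z := PF.dSup_le _ (hne.image _) hd' z (by rintro _ ⟨y, hy, rfl⟩; exact h y hy)

/-- Finite meets distribute over joins of families indexed by a directed order. -/
theorem le_of_forall_finite (PF : PreframeStr X) {ι P : Type*} [SemilatticeSup P] [Nonempty P] {s : Set ι}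
    (hs : s.Finite) (h : ι → P → X) (hmono : ∀ i, Monotone (h i)) (m : ι → X)
    (hm : ∀ i, IsLUB (Set.range (h i)) (m i)) {x z : X} (hx : ∀ i ∈ s, x ≤ m i)
    (hz : ∀ p, ∀ y ≤ x, (∀ i ∈ s, y ≤ h i p) → y ≤ z) : x ≤ z := by
  induction s, hs using Set.Finite.induction_on with
  | empty => exact hz (Classical.arbitrary P) x le_rfl (by simp)
  | @insert i s _ _ ih =>
    refine ih (fun j hj => hx j (Set.mem_insert_of_mem _ hj)) fun p y hy hyp => ?_
    refine PF.le_of_le_isLUB (Set.range_nonempty _)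
      (directedOn_range.2 (hmono i).directed_le) (hm i)
      (hy.trans (hx i (Set.mem_insert _ _))) ?_
    rintro _ ⟨q, rfl⟩
    refine hz (p ⊔ q) _ ((PF.inf_le_left _ _).trans hy) ?_
    rintro j (rfl | hj)
    · exact (PF.inf_le_right _ _).trans (hmono _ le_sup_right)
    · exact (PF.inf_le_left _ _).trans ((hyp j hj).trans (hmono _ le_sup_left))

end PreframeStr

/-! ### Hitting sets -/

/-- The subsets of `S` which meet every member of `𝒜`. -/
def hitters {S : Type*} (𝒜 : Set (Finset S)) : Set (Set S) :=
  {H | ∀ A ∈ 𝒜, ∃ a ∈ A, a ∈ H}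

/-- The minimal hitting sets live inside the union of the family. -/
def smallHitters {S : Type*} (𝒜 : Set (Finset S)) : Set (Set S) :=
  {H | H ∈ hitters 𝒜 ∧ H ⊆ ⋃ A ∈ 𝒜, (A : Set S)}

theorem finite_smallHitters {S : Type*} {𝒜 : Set (Finset S)} (h𝒜 : 𝒜.Finite) :
    (smallHitters 𝒜).Finite :=
  (h𝒜.biUnion fun A _ => A.finite_toSet).finite_subsets.subset fun _ hH => hH.2

theorem exists_smallHitters_subset {S : Type*} {𝒜 : Set (Finset S)} {H : Set S}
    (hH : H ∈ hitters 𝒜) : ∃ H' ∈ smallHitters 𝒜, H' ⊆ H := by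
  refine ⟨H ∩ ⋃ A ∈ 𝒜, (A : Set S), ⟨fun A hA => ?_, Set.inter_subset_right⟩,
    Set.inter_subset_left⟩
  obtain ⟨a, ha, haH⟩ := hH A hA
  exact ⟨a, ha, haH, Set.mem_biUnion hA ha⟩

section Extension

variable {S : Type*} {X : Type*} [PartialOrder X]

theorem isGLB_image_smallHitters_iff (g : Set S →o X) {𝒜 : Set (Finset S)} {m : X} :
    IsGLB (g '' smallHitters 𝒜) m ↔ IsGLB (g '' hitters 𝒜) m := by
  have : lowerBounds (g '' smallHitters 𝒜) = lowerBounds (g '' hitters 𝒜) := by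
    refine Set.Subset.antisymm ?_ (lowerBounds_mono_set (Set.image_mono fun _ h => h.1))
    rintro z hz _ ⟨H, hH, rfl⟩
    obtain ⟨H', hH', hle⟩ := exists_smallHitters_subset hH
    exact (hz ⟨H', hH', rfl⟩).trans (g.monotone hle)
  rw [IsGLB, IsGLB, this]

theorem exists_isGLB_hitters (PF : PreframeStr X) (g : Set S →o X)
    (𝒜 : Finset (Finset S)) :
    ∃ m, IsGLB (g '' hitters (𝒜 : Set (Finset S))) m := by
  obtain ⟨m, hm⟩ :=
    PF.exists_isGLB_of_finite ((finite_smallHitters 𝒜.finite_toSet).image g)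
  exact ⟨m, (isGLB_image_smallHitters_iff g).1 hm⟩

variable (PF : PreframeStr X) (g : Set S →o X)

/-- The value `⋀ {g H | H meets every A ∈ 𝒜}`, representing `⋁_{A ∈ 𝒜} ⋀ A`. -/
def meetHit (𝒜 : Finset (Finset S)) : X :=
  (exists_isGLB_hitters PF g 𝒜).choose

theorem isGLB_meetHit (𝒜 : Finset (Finset S)) :
    IsGLB (g '' hitters (𝒜 : Set (Finset S))) (meetHit PF g 𝒜) :=
  (exists_isGLB_hitters PF g 𝒜).choose_spec

variable {PF g}

theorem meetHit_le {𝒜 : Finset (Finset S)} {H : Set S}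
    (hH : ∀ A ∈ 𝒜, ∃ a ∈ A, a ∈ H) : meetHit PF g 𝒜 ≤ g H :=
  (isGLB_meetHit PF g 𝒜).1 ⟨H, hH, rfl⟩

theorem le_meetHit {𝒜 : Finset (Finset S)} {x : X}
    (h : ∀ H : Set S, (∀ A ∈ 𝒜, ∃ a ∈ A, a ∈ H) → x ≤ g H) : x ≤ meetHit PF g 𝒜 :=
  (isGLB_meetHit PF g 𝒜).2 (by rintro _ ⟨H, hH, rfl⟩; exact h H hH)

theorem meetHit_mono : Monotone (meetHit PF g) :=
  fun _ _ h => le_meetHit fun _ hH => meetHit_le fun A hA => hH A (h hA)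

theorem meetHit_family_nonempty (𝒰 : Set (Finset S)) :
    (meetHit PF g '' {𝒜 | (𝒜 : Set (Finset S)) ⊆ 𝒰}).Nonempty :=
  ⟨_, ∅, by simp, rfl⟩

theorem meetHit_family_directed (𝒰 : Set (Finset S)) :
    DirectedOn (· ≤ ·) (meetHit PF g '' {𝒜 | (𝒜 : Set (Finset S)) ⊆ 𝒰}) := by
  rintro _ ⟨𝒜, h𝒜, rfl⟩ _ ⟨ℬ, hℬ, rfl⟩
  refine ⟨_, ⟨𝒜 ∪ ℬ, ?_, rfl⟩, meetHit_mono Finset.subset_union_left,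
    meetHit_mono Finset.subset_union_right⟩
  simpa using ⟨h𝒜, hℬ⟩

variable (PF g)

/-- The directed join of `meetHit 𝒜` over the finite `𝒜 ⊆ 𝒰`. -/
def hitExt (𝒰 : Set (Finset S)) : X :=
  PF.dSup (meetHit PF g '' {𝒜 | (𝒜 : Set (Finset S)) ⊆ 𝒰})

theorem isLUB_hitExt (𝒰 : Set (Finset S)) :
    IsLUB (meetHit PF g '' {𝒜 | (𝒜 : Set (Finset S)) ⊆ 𝒰}) (hitExt PF g 𝒰) :=
  PF.isLUB_dSup (meetHit_family_nonempty 𝒰) (meetHit_family_directed 𝒰)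

variable {PF g}

theorem meetHit_le_hitExt {𝒜 : Finset (Finset S)} {𝒰 : Set (Finset S)}
    (h : (𝒜 : Set (Finset S)) ⊆ 𝒰) : meetHit PF g 𝒜 ≤ hitExt PF g 𝒰 :=
  (isLUB_hitExt PF g 𝒰).1 ⟨𝒜, h, rfl⟩

theorem hitExt_le {𝒰 : Set (Finset S)} {z : X}
    (h : ∀ 𝒜 : Finset (Finset S), (𝒜 : Set (Finset S)) ⊆ 𝒰 → meetHit PF g 𝒜 ≤ z) :
    hitExt PF g 𝒰 ≤ z :=
  (isLUB_hitExt PF g 𝒰).2 (by rintro _ ⟨𝒜, h𝒜, rfl⟩; exact h 𝒜 h𝒜)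

theorem hitExt_mono : Monotone (hitExt PF g) :=
  fun _ _ h => hitExt_le fun _ h𝒜 => meetHit_le_hitExt (h𝒜.trans h)

theorem hitExt_univ : hitExt PF g Set.univ = PF.top := by
  refine le_antisymm (PF.le_top _) (le_trans ?_
    (meetHit_le_hitExt (𝒜 := {∅}) (Set.subset_univ _)))
  exact le_meetHit fun H hH => by simpa using hH ∅

theorem inf_meetHit_le (𝒜 ℬ : Finset (Finset S)) :
    PF.inf (meetHit PF g 𝒜) (meetHit PF g ℬ) ≤
      meetHit PF g (Finset.image₂ (· ∪ ·) 𝒜 ℬ) := by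
  refine le_meetHit fun H hH => ?_
  by_cases hA : ∀ A ∈ 𝒜, ∃ a ∈ A, a ∈ H
  · exact (PF.inf_le_left _ _).trans (meetHit_le hA)
  · push Not at hA
    obtain ⟨A, hA, hAH⟩ := hA
    refine (PF.inf_le_right _ _).trans (meetHit_le fun B hB => ?_)
    obtain ⟨c, hc, hcH⟩ := hH _ (Finset.mem_image₂_of_mem hA hB)
    rcases Finset.mem_union.1 hc with hc | hc
    · exact absurd hcH (hAH c hc)
    · exact ⟨c, hc, hcH⟩

theorem inf_hitExt_le {𝒰 𝒱 𝒲 : Set (Finset S)}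
    (h : ∀ A ∈ 𝒰, ∀ B ∈ 𝒱, A ∪ B ∈ 𝒲) :
    PF.inf (hitExt PF g 𝒰) (hitExt PF g 𝒱) ≤ hitExt PF g 𝒲 := by
  refine PF.le_of_le_isLUB (meetHit_family_nonempty 𝒰) (meetHit_family_directed 𝒰)
    (isLUB_hitExt PF g 𝒰) (PF.inf_le_left _ _) ?_
  rintro _ ⟨𝒜, h𝒜, rfl⟩
  refine PF.le_of_le_isLUB (meetHit_family_nonempty 𝒱) (meetHit_family_directed 𝒱)
    (isLUB_hitExt PF g 𝒱) ((PF.inf_le_left _ _).trans (PF.inf_le_right _ _)) ?_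
  rintro _ ⟨ℬ, hℬ, rfl⟩
  refine le_trans (PF.le_inf _ _ _ ((PF.inf_le_left _ _).trans (PF.inf_le_right _ _))
    (PF.inf_le_right _ _)) ((inf_meetHit_le 𝒜 ℬ).trans (meetHit_le_hitExt ?_))
  intro C hC
  obtain ⟨A, hA, B, hB, rfl⟩ := Finset.mem_image₂.1 (Finset.mem_coe.1 hC)
  exact h A (h𝒜 hA) B (hℬ hB)

theorem hitExt_insert_le_of_subset {A B : Finset S} (h : B ⊆ A) (𝒰 : Set (Finset S)) :
    hitExt PF g (insert A 𝒰) ≤ hitExt PF g (insert B 𝒰) := by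
  refine hitExt_le fun 𝒜 h𝒜 => ?_
  refine le_trans ?_ (meetHit_le_hitExt (𝒜 := insert B (𝒜.erase A)) ?_)
  · refine le_meetHit fun H hH => meetHit_le fun C hC => ?_
    by_cases hCA : C = A
    · obtain ⟨b, hb, hbH⟩ := hH B (Finset.mem_insert_self _ _)
      exact ⟨b, hCA ▸ h hb, hbH⟩
    · exact hH C (Finset.mem_insert_of_mem (Finset.mem_erase.2 ⟨hCA, hC⟩))
  · intro C hC
    rcases Finset.mem_insert.1 (Finset.mem_coe.1 hC) with rfl | hC
    · exact Set.mem_insert _ _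
    · obtain ⟨hCA, hC⟩ := Finset.mem_erase.1 hC
      exact Set.mem_insert_of_mem _ ((h𝒜 hC).resolve_left hCA)

theorem hitExt_union_finset_le {𝒰 : Set (Finset S)} {𝒜 : Finset (Finset S)}
    (h : ∀ A ∈ 𝒜, ∀ 𝒱, 𝒰 ⊆ 𝒱 → hitExt PF g (insert A 𝒱) ≤ hitExt PF g 𝒱) :
    hitExt PF g (↑𝒜 ∪ 𝒰) ≤ hitExt PF g 𝒰 := by
  induction 𝒜 using Finset.induction_on with
  | empty => simp
  | insert A 𝒜 _ ih =>
    rw [Finset.coe_insert, Set.insert_union]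
    exact (h A (Finset.mem_insert_self _ _) _ Set.subset_union_right).trans
      (ih fun B hB => h B (Finset.mem_insert_of_mem hB))

variable {Ax : S → Set (Set S)}

/-- One application of a generating axiom, in a context `C`. -/
theorem hitExt_insert_axiom_le
    (hcov : ∀ H K : Set S, (∀ a ∈ H, BGen Ax a K) → g H ≤ g K)
    (hdir : ∀ H K : Set S, IsLUB (Set.range fun K₀ : Finset K =>
      g (H ∪ Subtype.val '' (K₀ : Set K))) (g (H ∪ K)))
    {a : S} {K : Set S} (hK : K ∈ Ax a) (C : Finset S) (𝒰 : Set (Finset S))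
    (h : ∀ b ∈ K, ∀ 𝒱, 𝒰 ⊆ 𝒱 → hitExt PF g (insert (C ∪ {b}) 𝒱) ≤ hitExt PF g 𝒱) :
    hitExt PF g (insert (C ∪ {a}) 𝒰) ≤ hitExt PF g 𝒰 := by
  refine hitExt_le fun 𝒜 h𝒜 => ?_
  set ℬ := 𝒜.erase (C ∪ {a})
  have hℬ𝒰 : (ℬ : Set (Finset S)) ⊆ 𝒰 := fun B hB => by
    obtain ⟨h1, h2⟩ := Finset.mem_erase.1 (Finset.mem_coe.1 hB)
    exact (h𝒜 h2).resolve_left h1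
  have hit : ∀ H : Set S, (∀ B ∈ ℬ, ∃ b ∈ B, b ∈ H) → (∃ c ∈ C ∪ {a}, c ∈ H) →
      meetHit PF g 𝒜 ≤ g H := fun H h1 h2 => meetHit_le fun A hA => by
    by_cases hAC : A = C ∪ {a}
    · exact hAC ▸ h2
    · exact h1 A (Finset.mem_erase.2 ⟨hAC, hA⟩)
  refine PF.le_of_forall_finite (finite_smallHitters ℬ.finite_toSet)
    (fun H (K₀ : Finset K) => g (H ∪ Subtype.val '' (K₀ : Set K)))
    (fun H K₀ K₁ hle => g.monotone (Set.union_subset_union_right _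
      (Set.image_mono (Finset.coe_subset.2 hle))))
    (fun H => g (H ∪ K)) (fun H => hdir H K) ?_ ?_
  · intro H hH
    refine (hit (H ∪ {a}) (fun B hB => ?_) ⟨a, by simp, by simp⟩).trans (hcov _ _ ?_)
    · obtain ⟨b, hb, hbH⟩ := hH.1 B hB
      exact ⟨b, hb, Or.inl hbH⟩
    · rintro x (hx | rfl)
      · exact BGen.refl (Or.inl hx)
      · exact BGen.infty K hK fun b hb => BGen.refl (Or.inr hb)
  · intro K₀ y hy hyH
    set 𝒟 : Finset (Finset S) := K₀.image fun b : K => C ∪ {(b : S)}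
    have key : y ≤ meetHit PF g (𝒟 ∪ ℬ) := by
      refine le_meetHit fun G hG => ?_
      have hGℬ : ∀ B ∈ ℬ, ∃ b ∈ B, b ∈ G := fun B hB => hG B (Finset.mem_union_right _ hB)
      by_cases hC : ∃ c ∈ C, c ∈ G
      · obtain ⟨c, hc, hcG⟩ := hC
        exact hy.trans (hit G hGℬ ⟨c, Finset.mem_union_left _ hc, hcG⟩)
      · obtain ⟨H, hH, hHG⟩ := exists_smallHitters_subset (𝒜 := (ℬ : Set (Finset S))) hGℬ
        refine (hyH H hH).trans (g.monotone (Set.union_subset hHG ?_))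
        rintro _ ⟨b, hb, rfl⟩
        obtain ⟨c, hc, hcG⟩ := hG (C ∪ {(b : S)})
          (Finset.mem_union_left _ (Finset.mem_image_of_mem _ hb))
        rcases Finset.mem_union.1 hc with hc | hc
        · exact absurd ⟨c, hc, hcG⟩ hC
        · rwa [← Finset.mem_singleton.1 hc]
    refine key.trans ((meetHit_le_hitExt (𝒰 := ↑𝒟 ∪ 𝒰) ?_).trans
      (hitExt_union_finset_le ?_))
    · rw [Finset.coe_union]
      exact Set.union_subset_union_right _ hℬ𝒰
    · intro D hD
      obtain ⟨b, -, rfl⟩ := Finset.mem_image.1 hD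
      exact h b b.2

theorem hitExt_insert_le_of_cov
    (hcov : ∀ H K : Set S, (∀ a ∈ H, BGen Ax a K) → g H ≤ g K)
    (hdir : ∀ H K : Set S, IsLUB (Set.range fun K₀ : Finset K =>
      g (H ∪ Subtype.val '' (K₀ : Set K))) (g (H ∪ K)))
    {A : Finset S} {𝒰 : Set (Finset S)} (hA : GCov (LowerThyAx Ax) A 𝒰) :
    ∀ 𝒱, 𝒰 ⊆ 𝒱 → hitExt PF g (insert A 𝒱) ≤ hitExt PF g 𝒱 := by
  induction hA with
  | refl hA => exact fun 𝒱 h => by rw [Set.insert_eq_of_mem (h hA)]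
  | le hBA _ ih => exact fun 𝒱 h => (hitExt_insert_le_of_subset hBA 𝒱).trans (ih 𝒱 h)
  | ax C hT _ ih =>
    obtain ⟨a, K, hK⟩ := hT
    exact fun 𝒱 h => hitExt_insert_axiom_le hcov hdir hK C 𝒱 fun b hb 𝒲 h𝒲 =>
      ih {b} ⟨b, hb, rfl⟩ 𝒲 (h.trans h𝒲)

theorem hitExt_le_of_cov
    (hcov : ∀ H K : Set S, (∀ a ∈ H, BGen Ax a K) → g H ≤ g K)
    (hdir : ∀ H K : Set S, IsLUB (Set.range fun K₀ : Finset K =>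
      g (H ∪ Subtype.val '' (K₀ : Set K))) (g (H ∪ K)))
    {𝒰 𝒱 : Set (Finset S)} (h : ∀ A ∈ 𝒰, GCov (LowerThyAx Ax) A 𝒱) :
    hitExt PF g 𝒰 ≤ hitExt PF g 𝒱 :=
  hitExt_le fun _ h𝒜 => (meetHit_le_hitExt (Set.subset_union_left (t := 𝒱))).trans
    (hitExt_union_finset_le fun A hA => hitExt_insert_le_of_cov hcov hdir (h A (h𝒜 hA)))

theorem hitExt_singletons
    (hdir : ∀ H K : Set S, IsLUB (Set.range fun K₀ : Finset K =>
      g (H ∪ Subtype.val '' (K₀ : Set K))) (g (H ∪ K))) (U : Set S) :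
    hitExt PF g {B | ∃ a ∈ U, B = {a}} = g U := by
  apply le_antisymm
  · refine hitExt_le fun 𝒜 h𝒜 => meetHit_le fun A hA => ?_
    obtain ⟨a, ha, rfl⟩ := h𝒜 hA
    exact ⟨a, Finset.mem_singleton_self a, ha⟩
  · have := hdir ∅ U
    rw [Set.empty_union] at this
    refine this.2 ?_
    rintro _ ⟨K₀, rfl⟩
    refine le_trans ?_ (meetHit_le_hitExt (𝒜 := K₀.image fun b : U => {(b : S)}) ?_)
    · refine le_meetHit fun H hH => g.monotone ?_
      rintro _ (⟨⟨⟩⟩ | ⟨b, hb, rfl⟩)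
      obtain ⟨c, hc, hcH⟩ := hH _ (Finset.mem_image_of_mem _ hb)
      rwa [← Finset.mem_singleton.1 hc]
    · intro B hB
      obtain ⟨b, -, rfl⟩ := Finset.mem_image.1 (Finset.mem_coe.1 hB)
      exact ⟨b, b.2, rfl⟩

end Extension

/-! ### Presented covers -/

section Presented

variable {P : Type*} {T : Finset P → Set (Finset P) → Prop}

theorem GCov_mono {A : Finset P} {𝒰 𝒱 : Set (Finset P)} (h : GCov T A 𝒰) (h' : 𝒰 ⊆ 𝒱) :
    GCov T A 𝒱 :=
  GCov_trans h fun _ hB => GCov.refl (h' hB)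

theorem GCov_union_left {A : Finset P} {𝒰 : Set (Finset P)} (h : GCov T A 𝒰)
    (C : Finset P) : GCov T (C ∪ A) {D | ∃ B ∈ 𝒰, D = C ∪ B} := by
  induction h with
  | refl hA => exact GCov.refl ⟨_, hA, rfl⟩
  | le hBA _ ih => exact GCov.le (Finset.union_subset_union_right hBA) ih
  | ax E hT _ ih =>
    rw [← Finset.union_assoc]
    exact GCov.ax _ hT fun B hB => by
      rw [Finset.union_assoc]
      exact ih B hB

theorem GCov_union {A : Finset P} {𝒰 𝒱 : Set (Finset P)} (h : GCov T A 𝒰)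
    (h' : GCov T A 𝒱) : GCov T A {D | ∃ B ∈ 𝒰, ∃ C ∈ 𝒱, D = B ∪ C} := by
  have := GCov_union_left h A
  rw [Finset.union_self] at this
  refine GCov_trans this ?_
  rintro _ ⟨B, hB, rfl⟩
  rw [Finset.union_comm]
  refine GCov_mono (GCov_union_left h' B) ?_
  rintro _ ⟨C, hC, rfl⟩
  exact ⟨B, hB, C, hC, rfl⟩

theorem GCov_insert_union {A B C : Finset P} {𝒰 : Set (Finset P)}
    (h : GCov T A (insert B 𝒰)) (h' : GCov T A (insert C 𝒰)) :
    GCov T A (insert (B ∪ C) 𝒰) := by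
  refine GCov_trans (GCov_union h h') ?_
  rintro _ ⟨B', rfl | hB, C', rfl | hC, rfl⟩
  · exact GCov.refl (Set.mem_insert _ _)
  · exact GCov.le Finset.subset_union_right (GCov.refl (Set.mem_insert_of_mem _ hC))
  · exact GCov.le Finset.subset_union_left (GCov.refl (Set.mem_insert_of_mem _ hB))
  · exact GCov.le Finset.subset_union_left (GCov.refl (Set.mem_insert_of_mem _ hB))

theorem GCov_insert_of_forall_singleton {A : Finset P} {𝒰 : Set (Finset P)} (B : Finset P)
    (h : ∀ b ∈ B, GCov T A (insert {b} 𝒰)) : GCov T A (insert B 𝒰) := by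
  induction B using Finset.induction_on with
  | empty => exact GCov.le (Finset.empty_subset _) (GCov.refl (Set.mem_insert _ _))
  | insert b B _ ih =>
    rw [Finset.insert_eq]
    exact GCov_insert_union (h b (Finset.mem_insert_self _ _))
      (ih fun c hc => h c (Finset.mem_insert_of_mem hc))

/-- A finite join of finite meets of generators is the meet, over the hitting sets, of the
joins of generators. -/
theorem GCov_of_forall_hitters {A : Finset P} (𝒜 : Finset (Finset P))
    (𝒱 : Set (Finset P))
    (h : ∀ H : Set P, H ∈ hitters (𝒜 : Set (Finset P)) →
      GCov T A ({B | ∃ a ∈ H, B = {a}} ∪ 𝒱)) :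
    GCov T A (↑𝒜 ∪ 𝒱) := by
  induction 𝒜 using Finset.induction_on generalizing 𝒱 with
  | empty => exact GCov_mono (h ∅ (by simp [hitters])) (by simp)
  | insert B 𝒜 _ ih =>
    rw [Finset.coe_insert, Set.insert_union]
    refine GCov_insert_of_forall_singleton B fun b hb => ?_
    rw [← Set.union_insert]
    refine ih _ fun H hH => GCov_mono (h (insert b H) ?_) ?_
    · intro C hC
      rcases Finset.mem_insert.1 (Finset.mem_coe.1 hC) with rfl | hC
      · exact ⟨b, hb, Set.mem_insert _ _⟩
      · obtain ⟨c, hc, hcH⟩ := hH C hC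
        exact ⟨c, hc, Set.mem_insert_of_mem _ hcH⟩
    · rintro _ (⟨a, rfl | ha, rfl⟩ | hV)
      · exact Or.inr (Set.mem_insert _ _)
      · exact Or.inl ⟨a, ha, rfl⟩
      · exact Or.inr (Set.mem_insert_of_mem _ hV)

theorem coe_satInfL (U V : SatSet (GCov T)) :
    (satInfL T U V : Set (Finset P)) = (U : Set (Finset P)) ∩ V := by
  ext A
  constructor
  · intro h
    constructor
    · refine U.2 A (GCov_trans h ?_)
      rintro B ⟨C, hC, _, _, hCB, _⟩
      exact GCov.le hCB (GCov.refl hC)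
    · refine V.2 A (GCov_trans h ?_)
      rintro B ⟨_, _, C, hC, _, hCB⟩
      exact GCov.le hCB (GCov.refl hC)
  · rintro ⟨hU, hV⟩
    exact GCov.refl ⟨A, hU, A, hV, Finset.Subset.refl _, Finset.Subset.refl _⟩

/-- The saturation of a set of basic opens of a presented topology. -/
def satGen (T : Finset P → Set (Finset P) → Prop) (𝒰 : Set (Finset P)) : SatSet (GCov T) :=
  ⟨{A | GCov T A 𝒰}, fun _ h => GCov_trans h fun _ hB => hB⟩

theorem satGen_le {𝒰 : Set (Finset P)} {V : SatSet (GCov T)} (h : 𝒰 ⊆ V) :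
    satGen T 𝒰 ≤ V :=
  fun _ hA => V.2 _ (GCov_mono hA h)

theorem satGen_mono : Monotone (satGen T) :=
  fun _ _ h _ hA => GCov_mono hA h

theorem satGen_family_directed (𝒰 : Set (Finset P)) :
    DirectedOn (· ≤ ·)
      ((fun 𝒜 : Finset (Finset P) => satGen T ↑𝒜) '' {𝒜 | (𝒜 : Set (Finset P)) ⊆ 𝒰}) := by
  rintro _ ⟨𝒜, h𝒜, rfl⟩ _ ⟨ℬ, hℬ, rfl⟩
  refine ⟨_, ⟨𝒜 ∪ ℬ, ?_, rfl⟩, satGen_mono ?_, satGen_mono ?_⟩ <;> simp_all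

theorem satSup_satGen_family (U : SatSet (GCov T)) :
    satSup (GCov_isBasicCover T)
      ((fun 𝒜 : Finset (Finset P) => satGen T ↑𝒜) ''
        {𝒜 | (𝒜 : Set (Finset P)) ⊆ U}) = U := by
  apply le_antisymm
  · intro A hA
    refine U.2 A (GCov_mono hA (Set.iUnion₂_subset ?_))
    rintro _ ⟨𝒜, h𝒜, rfl⟩
    exact satGen_le h𝒜
  · intro A hA
    refine GCov.refl (Set.mem_biUnion ⟨{A}, by simpa using hA, rfl⟩ ?_)
    exact GCov.refl (by simp)

variable {X : Type*} [PartialOrder X] {PF : PreframeStr X}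

theorem IsPreframeHomL.isGLB_image {F : SatSet (GCov T) → X} (hF : IsPreframeHomL T PF F)
    {t : Set (SatSet (GCov T))} (ht : t.Finite) {W : SatSet (GCov T)} (hW : IsGLB t W) :
    IsGLB (F '' t) (F W) := by
  suffices ∃ W, IsGLB t W ∧ IsGLB (F '' t) (F W) by
    obtain ⟨W', h1, h2⟩ := this
    rwa [hW.unique h1]
  clear hW
  induction t, ht using Set.Finite.induction_on with
  | empty =>
    refine ⟨satTop T, ⟨by simp, fun z _ => Set.subset_univ _⟩, ?_⟩
    rw [hF.2.1, Set.image_empty]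
    exact ⟨by simp, fun z _ => PF.le_top z⟩
  | @insert U s _ _ ih =>
    obtain ⟨W', h1, h2⟩ := ih
    refine ⟨satInfL T U W', ⟨?_, ?_⟩, ?_⟩
    · rintro V (rfl | hV) A hA
      · exact ((coe_satInfL _ _).subset hA).1
      · exact h1.1 hV ((coe_satInfL _ _).subset hA).2
    · intro Z hZ A hA
      refine (coe_satInfL _ _).superset ⟨hZ (Set.mem_insert _ _) hA, ?_⟩
      exact h1.2 (fun V hV => hZ (Set.mem_insert_of_mem _ hV)) hA
    · rw [hF.2.2.1, Set.image_insert_eq]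
      exact PF.isGLB_insert h2

end Presented

/-! ### The saturated subsets of `S` -/

section Base

variable {S : Type*} (Ax : S → Set (Set S))

/-- The saturation of a subset of `S`. -/
def satBase (U : Set S) : SatSet (BGen Ax) :=
  ⟨{a | BGen Ax a U}, fun _ h => BGen_trans h fun _ hb => hb⟩

variable {Ax}

theorem satBase_le_satBase {U V : Set S} (h : ∀ a ∈ U, BGen Ax a V) :
    satBase Ax U ≤ satBase Ax V :=
  fun _ ha => BGen_trans ha h

theorem satBase_coe (U : SatSet (BGen Ax)) : satBase Ax (U : Set S) = U :=
  Subtype.ext (Set.Subset.antisymm U.2 fun _ ha => BGen.refl ha)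

theorem GCov_singleton_of_BGen {a : S} {U : Set S} (h : BGen Ax a U) :
    GCov (LowerThyAx Ax) {a} {B | ∃ b ∈ U, B = {b}} := by
  induction h with
  | refl ha => exact GCov.refl ⟨_, ha, rfl⟩
  | infty C hC _ ih =>
    rw [← Finset.empty_union {_}]
    refine GCov.ax ∅ (LowerThyAx.mk _ C hC) ?_
    rintro _ ⟨b, hb, rfl⟩
    rw [Finset.empty_union]
    exact ih b hb

theorem sigmaStar_satBase (U : Set S) :
    sigmaStar Ax (satBase Ax U) = satGen (LowerThyAx Ax) {B | ∃ a ∈ U, B = {a}} := by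
  apply le_antisymm
  · intro A hA
    refine GCov_trans hA ?_
    rintro B ⟨a, ha, hBa⟩
    exact GCov_trans hBa fun C hC => by
      rw [Set.mem_singleton_iff.1 hC]
      exact GCov_singleton_of_BGen ha
  · intro A hA
    refine GCov_mono hA ?_
    rintro _ ⟨a, ha, rfl⟩
    exact ⟨a, BGen.refl ha, GCov.refl rfl⟩

theorem isGLB_satGen (𝒜 : Finset (Finset S)) :
    IsGLB ((fun H => sigmaStar Ax (satBase Ax H)) '' smallHitters (𝒜 : Set (Finset S)))
      (satGen (LowerThyAx Ax) ↑𝒜) := by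
  constructor
  · rintro _ ⟨H, hH, rfl⟩
    simp only [sigmaStar_satBase]
    refine satGen_le fun A hA => ?_
    obtain ⟨a, ha, haH⟩ := hH.1 A hA
    exact GCov.le (Finset.singleton_subset_iff.2 ha) (GCov.refl ⟨a, haH, rfl⟩)
  · intro Z hZ A hA
    have := GCov_of_forall_hitters (T := LowerThyAx Ax) (A := A) 𝒜 ∅ fun H hH => ?_
    · rwa [Set.union_empty] at this
    · obtain ⟨H', hH', hle⟩ := exists_smallHitters_subset hH
      have hAH : A ∈ (sigmaStar Ax (satBase Ax H') : Set (Finset S)) := hZ ⟨H', hH', rfl⟩ hA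
      rw [sigmaStar_satBase] at hAH
      refine GCov_mono hAH ?_
      rintro _ ⟨a, ha, rfl⟩
      exact Or.inl ⟨a, hle ha, rfl⟩

variable {X : Type*} [PartialOrder X] {PF : PreframeStr X} {f : SatSet (BGen Ax) → X}

/-- A monotone map on saturated subsets, as a monotone map on all subsets. -/
def onSubsets (hf : Monotone f) : Set S →o X where
  toFun U := f (satBase Ax U)
  monotone' _ _ h := hf (satBase_le_satBase fun _ ha => BGen.refl (h ha))

theorem onSubsets_le (hf : Monotone f) (H K : Set S) (h : ∀ a ∈ H, BGen Ax a K) :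
    onSubsets hf H ≤ onSubsets hf K :=
  hf (satBase_le_satBase h)

theorem isLUB_onSubsets_union (hf : IsDcpoHom (BGen_isBasicCover Ax) PF f) (H K : Set S) :
    IsLUB (Set.range fun K₀ : Finset K => onSubsets hf.1 (H ∪ Subtype.val '' (K₀ : Set K)))
      (onSubsets hf.1 (H ∪ K)) := by
  set s : Finset K → SatSet (BGen Ax) :=
    fun K₀ => satBase Ax (H ∪ Subtype.val '' (K₀ : Set K))
  have hmono : Monotone s := fun K₀ K₁ h => satBase_le_satBase fun a ha =>
    BGen.refl (Set.union_subset_union_right _ (Set.image_mono (Finset.coe_subset.2 h)) ha)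
  have hsup : satSup (BGen_isBasicCover Ax) (Set.range s) = satBase Ax (H ∪ K) := by
    apply le_antisymm
    · intro a ha
      refine BGen_trans (U := ⋃ U ∈ Set.range s, (U : Set S)) ha fun b hb => ?_
      obtain ⟨_, ⟨K₀, rfl⟩, hb⟩ := Set.mem_iUnion₂.1 hb
      refine BGen_trans hb fun c hc => BGen.refl ?_
      rcases hc with hc | ⟨c, -, rfl⟩
      · exact Or.inl hc
      · exact Or.inr c.2
    · intro a ha
      refine BGen_trans ha fun b hb => BGen.refl ?_
      rcases hb with hb | hb
      · exact Set.mem_biUnion ⟨∅, rfl⟩ (BGen.refl (Or.inl hb))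
      · exact Set.mem_biUnion ⟨{⟨b, hb⟩}, rfl⟩ (BGen.refl (Or.inr ⟨⟨b, hb⟩, by simp, rfl⟩))
  have hr : (Set.range fun K₀ : Finset K =>
      onSubsets hf.1 (H ∪ Subtype.val '' (K₀ : Set K))) = f '' Set.range s := by
    rw [← Set.range_comp]
    rfl
  have hval : onSubsets hf.1 (H ∪ K) = PF.dSup (f '' Set.range s) := by
    rw [← hf.2 _ (Set.range_nonempty s) (directedOn_range.2 hmono.directed_le), hsup]
    rfl
  rw [hr, hval, ← Set.range_comp]
  exact PF.isLUB_dSup (Set.range_nonempty _)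
    (directedOn_range.2 (hf.1.comp hmono).directed_le)

/-- The preframe homomorphism induced by a dcpo homomorphism. -/
theorem isPreframeHomL_hitExt (hf : IsDcpoHom (BGen_isBasicCover Ax) PF f) :
    IsPreframeHomL (LowerThyAx Ax) PF fun U => hitExt PF (onSubsets hf.1) U := by
  have hmono : Monotone fun U : SatSet (GCov (LowerThyAx Ax)) =>
      hitExt PF (onSubsets hf.1) (U : Set (Finset S)) := fun _ _ h => hitExt_mono h
  refine ⟨hmono, hitExt_univ, fun U V => ?_, fun D hne hD => ?_⟩
  · simp only [coe_satInfL]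
    refine le_antisymm (PF.le_inf _ _ _ (hitExt_mono Set.inter_subset_left)
      (hitExt_mono Set.inter_subset_right)) (inf_hitExt_le fun A hA B hB => ⟨?_, ?_⟩)
    · exact U.2 _ (GCov.le Finset.subset_union_left (GCov.refl hA))
    · exact V.2 _ (GCov.le Finset.subset_union_right (GCov.refl hB))
  · have hlub := PF.isLUB_dSup (hne.image _) (hD.mono_comp hmono)
    apply le_antisymm
    · refine (hitExt_le_of_cov (onSubsets_le hf.1) (isLUB_onSubsets_union hf)
        (𝒱 := ⋃ U ∈ D, (U : Set (Finset S))) fun A hA => hA).trans ?_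
      refine hitExt_le fun 𝒜 h𝒜 => ?_
      obtain ⟨U, hU, h𝒜U⟩ : ∃ U ∈ D, (𝒜 : Set (Finset S)) ⊆ U :=
        DirectedOn.exists_mem_subset_of_finset_subset_biUnion hne hD h𝒜
      exact (meetHit_le_hitExt h𝒜U).trans (hlub.1 ⟨U, hU, rfl⟩)
    · refine hlub.2 ?_
      rintro _ ⟨U, hU, rfl⟩
      exact hmono fun A hA => GCov.refl (Set.mem_biUnion hU hA)

theorem hitExt_sigmaStar (hf : IsDcpoHom (BGen_isBasicCover Ax) PF f)
    (U : SatSet (BGen Ax)) :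
    hitExt PF (onSubsets hf.1) (sigmaStar Ax U : Set (Finset S)) = f U := by
  have hU : onSubsets hf.1 (U : Set S) = f U := congrArg f (satBase_coe U)
  rw [← hU, ← hitExt_singletons (PF := PF) (isLUB_onSubsets_union hf)]
  rw [← congrArg (sigmaStar Ax) (satBase_coe U), sigmaStar_satBase]
  exact le_antisymm (hitExt_le_of_cov (onSubsets_le hf.1) (isLUB_onSubsets_union hf)
    fun A hA => hA) (hitExt_mono fun A hA => GCov.refl hA)

theorem IsPreframeHomL.eq_hitExt (hf : Monotone f)
    {F : SatSet (GCov (LowerThyAx Ax)) → X} (hF : IsPreframeHomL (LowerThyAx Ax) PF F)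
    (hFf : ∀ U, F (sigmaStar Ax U) = f U) (U : SatSet (GCov (LowerThyAx Ax))) :
    F U = hitExt PF (onSubsets hf) U := by
  have hfin : ∀ 𝒜 : Finset (Finset S),
      F (satGen (LowerThyAx Ax) ↑𝒜) = meetHit PF (onSubsets hf) 𝒜 := by
    intro 𝒜
    have h := hF.isGLB_image ((finite_smallHitters 𝒜.finite_toSet).image _)
      (isGLB_satGen (Ax := Ax) 𝒜)
    rw [Set.image_image] at h
    simp only [hFf] at h
    exact ((isGLB_image_smallHitters_iff (onSubsets hf)).1 h).unique (isGLB_meetHit _ _ 𝒜)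
  conv_lhs => rw [← satSup_satGen_family U]
  rw [hF.2.2.2 _ (Set.Nonempty.image _ ⟨∅, by simp⟩) (satGen_family_directed _),
    Set.image_image]
  simp only [hfin]
  rfl

end Base

/-- Preframe coverage: for an inductively generated basic cover
`S` (generated by the axiom-set `Ax`), every dcpo homomorphism
`f : Sat(S) → X` into a preframe `X` factors uniquely through
`σ_L* : Sat(S) → Sat(Lower(S))` by a preframe homomorphism. -/
theorem preframe_coverage {S : Type u} (Ax : S → Set (Set S))
    {X : Type v} [PartialOrder X] (PF : PreframeStr X)
    (f : SatSet (BGen Ax) → X)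
    (hf : IsDcpoHom (BGen_isBasicCover Ax) PF f) :
    ∃! F : SatSet (GCov (LowerThyAx Ax)) → X,
      IsPreframeHomL (LowerThyAx Ax) PF F ∧ ∀ U, F (sigmaStar Ax U) = f U :=
  ⟨_, ⟨isPreframeHomL_hitExt hf, hitExt_sigmaStar hf⟩,
    fun _ hF => funext (hF.1.eq_hitExt hf.1 hF.2)⟩

end FTP
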